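/- arXiv:2412.19799 — 3 statements merged into one kernel-verified Lean document; each statement's English description precedes it below -/
import Mathlib

section
/- Let φ be a degree-zero endomorphism of M and let λ_1, …, λ_r ∈ k be distinct eigenvalues of the induced k-linear map A on M/𝔪M, with respective algebraic multiplicities μ_1, …, μ_r as roots of the characteristic polynomial of A. Set ψ_j = (φ − λ_j·id_M)^{μ_j} and ψ = ψ_1 ∘ ⋯ ∘ ψ_r. Then M is the internal direct sum M = ker ψ_1 ⊕ ⋯ ⊕ ker ψ_r ⊕ im ψ of graded submodules, with each ker ψ_j ≠ 0. -/
open Polynomial in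
theorem aux_charpoly_mul {K V : Type*} [Field K] [AddCommGroup V] [Module K V] [Module.Finite K V]
    (W : Submodule K V) (e : V →ₗ[K] V) (he : W ≤ W.comap e) :
    e.charpoly = (e.restrict he).charpoly * (W.mapQ W e he).charpoly := by
  let m := Module.Free.ChooseBasisIndex K W
  let bW : Module.Basis m K W := Module.Free.chooseBasis K W
  let n := Module.Free.ChooseBasisIndex K (V ⧸ W)
  let bQ : Module.Basis n K (V ⧸ W) := Module.Free.chooseBasis K (V ⧸ W)
  let b := Module.Basis.sumQuot bW bQ
  let A : Matrix m m K := LinearMap.toMatrix bW bW (e.restrict he)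
  let B : Matrix m n K := Matrix.of fun i l ↦
    ((Module.Basis.sumQuot bW bQ).repr (e ((Module.Basis.sumQuot bW bQ) (Sum.inr l)))) (Sum.inl i)
  let D : Matrix n n K := LinearMap.toMatrix bQ bQ (W.mapQ W e he)
  suffices LinearMap.toMatrix b b e = Matrix.fromBlocks A B 0 D by
    rw [← LinearMap.charpoly_toMatrix e b, this, ← LinearMap.charpoly_toMatrix _ bW,
      ← LinearMap.charpoly_toMatrix _ bQ, Matrix.charpoly_fromBlocks_zero₂₁]
  ext u v
  cases u with
  | inl i =>
    cases v with
    | inl k =>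
      simp only [b, Module.Basis.sumQuot_inl, Matrix.fromBlocks_apply₁₁, A, LinearMap.toMatrix_apply]
      apply Module.Basis.sumQuot_repr_inl_of_mem
    | inr l => simp [b, LinearMap.toMatrix_apply, Matrix.fromBlocks_apply₁₂, B]
  | inr j =>
    cases v with
    | inl k =>
      suffices W.mkQ (e (bW k)) = 0 by simp [LinearMap.toMatrix_apply, b, this]
      rw [← LinearMap.mem_ker, Submodule.ker_mkQ]
      exact he (Submodule.coe_mem (bW k))
    | inr l =>
      simp only [LinearMap.toMatrix_apply, Module.Basis.sumQuot_repr_inr,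
        Matrix.fromBlocks_apply₂₂, D, b]
      have h : bQ l = W.mkQ ((Module.Basis.sumQuot bW bQ) (Sum.inr l)) := by simp
      rw [h]
      rfl

open Polynomial in
theorem aux_mapQ_aeval {K V : Type*} [Field K] [AddCommGroup V] [Module K V]
    (W : Submodule K V) (e : V →ₗ[K] V) (he : W ≤ W.comap e) (p : K[X]) (v : V) :
    aeval (W.mapQ W e he) p (Submodule.Quotient.mk v) = Submodule.Quotient.mk (aeval e p v) := by
  induction p using Polynomial.induction_on generalizing v with
  | C a => simp [Module.algebraMap_end_apply]
  | add p q hp hq => simp [hp, hq]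
  | monomial n a h =>
    rw [pow_succ, ← mul_assoc, map_mul, map_mul (aeval e)]
    simp only [aeval_X, Module.End.mul_apply, Submodule.mapQ_apply, h]

open Polynomial in
theorem aux_restrict_aeval {K V : Type*} [Field K] [AddCommGroup V] [Module K V]
    (W : Submodule K V) (e : V →ₗ[K] V) (he : ∀ x ∈ W, e x ∈ W) (p : K[X]) (v : W) :
    ((aeval (e.restrict he) p v : W) : V) = aeval e p (v : V) := by
  induction p using Polynomial.induction_on generalizing v with
  | C a => simp [Module.algebraMap_end_apply]
  | add p q hp hq => simp [hp, hq]
  | monomial n a h =>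
    rw [pow_succ, ← mul_assoc, map_mul, map_mul (aeval e)]
    simp only [aeval_X, Module.End.mul_apply, h, LinearMap.coe_restrict_apply]

open Polynomial in
theorem aux_step {K V : Type*} [Field K] [AddCommGroup V] [Module K V] [Module.Finite K V]
    (W W' : Submodule K V) (hWW : W ≤ W') (e : V →ₗ[K] V) (he : ∀ x ∈ W, e x ∈ W)
    (he' : ∀ x ∈ W', e x ∈ W') :
    ∃ q : K[X], (e.restrict he').charpoly = (e.restrict he).charpoly * q ∧
      ∀ x ∈ W', aeval e q x ∈ W := by
  let U : Submodule K W' := W.comap W'.subtype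
  let g := e.restrict he'
  have hg : U ≤ U.comap g := fun x hx => he _ hx
  refine ⟨(U.mapQ U g hg).charpoly, ?_, ?_⟩
  · have h1 := aux_charpoly_mul U g hg
    have h2 : (g.restrict hg).charpoly = (e.restrict he).charpoly := by
      rw [← (Submodule.comapSubtypeEquivOfLe hWW).charpoly_conj]
      congr 1
    rw [← h2]; exact h1
  · intro x hx
    have h := aux_mapQ_aeval U g hg (U.mapQ U g hg).charpoly ⟨x, hx⟩
    rw [LinearMap.aeval_self_charpoly, LinearMap.zero_apply, eq_comm,
      Submodule.Quotient.mk_eq_zero] at h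
    have h3 : ((aeval g (U.mapQ U g hg).charpoly ⟨x, hx⟩ : W') : V) ∈ W := h
    rwa [aux_restrict_aeval] at h3

theorem aux_internal {ι R M : Type*} [Fintype ι] [DecidableEq ι] [CommRing R] [AddCommGroup M]
    [Module R M] (N : ι → Submodule R M) (E : ι → Module.End R M) (hE : ∑ i, E i = 1)
    (h1 : ∀ i x, E i x ∈ N i) (h2 : ∀ i j, i ≠ j → ∀ x ∈ N j, E i x = 0) :
    DirectSum.IsInternal N := by
  have hs : ∀ x, ∑ i, E i x = x := fun x => by
    rw [← LinearMap.sum_apply, hE, Module.End.one_apply]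
  have hself : ∀ i, ∀ x ∈ N i, E i x = x := by
    intro i x hx
    conv_rhs => rw [← hs x]
    rw [Finset.sum_eq_single i]
    · intro j _ hj
      exact h2 j i hj x hx
    · simp
  rw [DirectSum.isInternal_submodule_iff_iSupIndep_and_iSup_eq_top]
  constructor
  · rw [iSupIndep_def]
    intro i
    rw [Submodule.disjoint_def]
    intro x hx hx'
    rw [← hself i x hx]
    have : (⨆ j, ⨆ (_ : j ≠ i), N j) ≤ LinearMap.ker (E i) :=
      iSup₂_le fun j hj y hy => h2 i j hj.symm y hy
    exact this hx'
  · rw [eq_top_iff]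
    intro x _
    rw [← hs x]
    exact Submodule.sum_mem _ fun i _ => Submodule.mem_iSup_of_mem i (h1 i x)

section aux
open Polynomial

variable {k R M : Type*} [Field k] [CommRing R] [Algebra k R]
    [AddCommGroup M] [Module k M] [Module R M] [IsScalarTower k R M]

theorem aux_aeval_mem (ℳ : ℕ → Submodule k M) (φ : Module.End R M)
    (hφ : ∀ i : ℕ, ∀ x ∈ ℳ i, φ x ∈ ℳ i) (p : k[X]) (i : ℕ) (x : M) (hx : x ∈ ℳ i) :
    aeval φ p x ∈ ℳ i := by
  induction p using Polynomial.induction_on generalizing x with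
  | C a =>
    rw [aeval_C, Module.algebraMap_end_apply]
    exact (ℳ i).smul_mem a hx
  | add p q hp hq =>
    rw [map_add, LinearMap.add_apply]
    exact (ℳ i).add_mem (hp x hx) (hq x hx)
  | monomial n a h =>
    rw [pow_succ, ← mul_assoc, map_mul, aeval_X, Module.End.mul_apply]
    exact h _ (hφ i x hx)

theorem aux_mk_aeval (mM : Submodule R M) (φ : Module.End R M) (A : Module.End k (M ⧸ mM))
    (hA : ∀ x : M, A (Submodule.Quotient.mk x) = Submodule.Quotient.mk (φ x)) (p : k[X]) (x : M) :
    aeval A p (Submodule.Quotient.mk x) = Submodule.Quotient.mk (aeval φ p x) := by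
  induction p using Polynomial.induction_on generalizing x with
  | C a =>
    rw [aeval_C, Module.algebraMap_end_apply, aeval_C, Module.algebraMap_end_apply]
    rfl
  | add p q hp hq => simp [hp, hq]
  | monomial n a h =>
    rw [pow_succ, ← mul_assoc, map_mul, map_mul (aeval φ)]
    simp only [aeval_X, Module.End.mul_apply, hA, h]

theorem aux_decompose (ℳ : ℕ → Submodule k M) [DirectSum.Decomposition ℳ] (f : Module.End R M)
    (hf : ∀ i : ℕ, ∀ x ∈ ℳ i, f x ∈ ℳ i) (x : M) (i : ℕ) :
    (DirectSum.decompose ℳ (f x) i : M) = f (DirectSum.decompose ℳ x i) := by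
  induction x using DirectSum.Decomposition.inductionOn ℳ with
  | zero => simp
  | @homogeneous j m =>
    by_cases h : j = i
    · subst h
      rw [DirectSum.decompose_of_mem_same ℳ (hf j m m.2),
        DirectSum.decompose_of_mem_same ℳ m.2]
    · rw [DirectSum.decompose_of_mem_ne ℳ (hf j m m.2) h,
        DirectSum.decompose_of_mem_ne ℳ m.2 h, map_zero]
  | add m m' h h' => simp [h, h']

/-- The `R`-submodule generated by homogeneous elements of degree below `d`. -/
def auxN (R : Type*) [CommRing R] [Module R M] (ℳ : ℕ → Submodule k M) (d : ℕ) : Submodule R M :=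
  Submodule.span R {x | ∃ i, i < d ∧ x ∈ ℳ i}

theorem aux_smul_comp (𝒜 : ℕ → Submodule k R) [GradedAlgebra 𝒜]
    (ℳ : ℕ → Submodule k M) [SetLike.GradedSMul 𝒜 ℳ] [DirectSum.Decomposition ℳ]
    (d i : ℕ) (a : R) (y : M) (hy : y ∈ ℳ i)
    (h : i < d ∨ a ∈ (HomogeneousIdeal.irrelevant 𝒜).toIdeal) :
    (DirectSum.decompose ℳ (a • y) d : M) ∈ auxN R ℳ d := by
  classical
  have e : a • y = ∑ j ∈ (DirectSum.decompose 𝒜 a).support,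
      (DirectSum.decompose 𝒜 a j : R) • y := by
    rw [← Finset.sum_smul, DirectSum.sum_support_decompose]
  rw [e, DirectSum.decompose_sum, DFinsupp.finsetSum_apply, AddSubmonoidClass.coe_finsetSum]
  refine Submodule.sum_mem _ fun j _ => ?_
  have hm : (DirectSum.decompose 𝒜 a j : R) • y ∈ ℳ (j +ᵥ i) :=
    SetLike.GradedSMul.smul_mem (SetLike.coe_mem _) hy
  rw [vadd_eq_add] at hm
  by_cases hd : j + i = d
  · subst hd
    rw [DirectSum.decompose_of_mem_same ℳ hm]
    by_cases hi : i < j + i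
    · exact Submodule.smul_mem _ _ (Submodule.subset_span ⟨i, hi, hy⟩)
    · have hj : j = 0 := by omega
      have ha := h.resolve_left hi
      have ha' : (DirectSum.decompose 𝒜 a 0 : R) = 0 := ha
      subst hj
      rw [ha', zero_smul]
      exact Submodule.zero_mem _
  · rw [DirectSum.decompose_of_mem_ne ℳ hm hd]
    exact Submodule.zero_mem _

theorem aux_comp_mem (𝒜 : ℕ → Submodule k R) [GradedAlgebra 𝒜]
    (ℳ : ℕ → Submodule k M) [SetLike.GradedSMul 𝒜 ℳ] [DirectSum.Decomposition ℳ]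
    (d : ℕ) (x : M)
    (hx : x ∈ auxN R ℳ d ⊔ (HomogeneousIdeal.irrelevant 𝒜).toIdeal • (⊤ : Submodule R M)) :
    (DirectSum.decompose ℳ x d : M) ∈ auxN R ℳ d := by
  obtain ⟨y, hy, z, hz, rfl⟩ := Submodule.mem_sup.1 hx
  rw [DirectSum.decompose_add, DirectSum.add_apply, Submodule.coe_add]
  refine Submodule.add_mem _ ?_ ?_
  · have : ∀ a : R, (DirectSum.decompose ℳ (a • y) d : M) ∈ auxN R ℳ d := by
      clear hx
      unfold auxN at hy
      induction hy using Submodule.span_induction with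
      | mem x h =>
        obtain ⟨i, hi, hxi⟩ := h
        exact fun a => aux_smul_comp 𝒜 ℳ d i a x hxi (Or.inl hi)
      | zero => simp
      | add x y _ _ h h' =>
        intro a
        rw [smul_add, DirectSum.decompose_add, DirectSum.add_apply, Submodule.coe_add]
        exact Submodule.add_mem _ (h a) (h' a)
      | smul b x _ h =>
        intro a
        rw [smul_smul]
        exact h _
    simpa using this 1
  · clear hx
    refine Submodule.smul_induction_on hz ?_ ?_
    · intro a ha m _
      induction m using DirectSum.Decomposition.inductionOn ℳ with
      | zero => simp
      | @homogeneous j m => exact aux_smul_comp 𝒜 ℳ d j a m m.2 (Or.inr ha)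
      | add m m' h h' =>
        rw [smul_add, DirectSum.decompose_add, DirectSum.add_apply, Submodule.coe_add]
        exact Submodule.add_mem _ (h trivial) (h' trivial)
    · intro x y h h'
      rw [DirectSum.decompose_add, DirectSum.add_apply, Submodule.coe_add]
      exact Submodule.add_mem _ h h'

theorem auxN_map (ℳ : ℕ → Submodule k M) (f : Module.End R M)
    (hf : ∀ i : ℕ, ∀ x ∈ ℳ i, f x ∈ ℳ i) (d : ℕ) : ∀ x ∈ auxN R ℳ d, f x ∈ auxN R ℳ d := by
  have : auxN R ℳ d ≤ (auxN R ℳ d).comap f := by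
    refine Submodule.span_le.2 ?_
    rintro x ⟨i, hi, hx⟩
    exact Submodule.subset_span ⟨i, hi, hf i x hx⟩
  exact this

theorem auxN_mono (ℳ : ℕ → Submodule k M) : Monotone (auxN R ℳ) := fun _ _ h =>
  Submodule.span_mono fun _ ⟨i, hi, hx⟩ => ⟨i, hi.trans_le h, hx⟩

theorem auxN_top (ℳ : ℕ → Submodule k M) [DirectSum.Decomposition ℳ] [Module.Finite R M] :
    ∃ D, auxN R ℳ D = ⊤ := by
  let N : ℕ →o Submodule R M := ⟨auxN R ℳ, auxN_mono ℳ⟩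
  have h : iSup N = ⊤ := by
    rw [eq_top_iff]
    intro x _
    induction x using DirectSum.Decomposition.inductionOn ℳ with
    | zero => exact Submodule.zero_mem _
    | @homogeneous j m =>
      exact Submodule.mem_iSup_of_mem (j + 1) (Submodule.subset_span ⟨j, Nat.lt_succ_self j, m.2⟩)
    | add m m' h h' => exact Submodule.add_mem _ (h trivial) (h' trivial)
  obtain ⟨n, hn⟩ := Submodule.FG.stabilizes_of_iSup_eq Module.Finite.fg_top N h
  exact ⟨n, hn.symm⟩

theorem aux_cayley (𝒜 : ℕ → Submodule k R) [GradedAlgebra 𝒜] [Module.Finite R M]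
    (ℳ : ℕ → Submodule k M) [SetLike.GradedSMul 𝒜 ℳ] [DirectSum.Decomposition ℳ]
    (mM : Submodule R M) (hmM : mM = (HomogeneousIdeal.irrelevant 𝒜).toIdeal • ⊤)
    [Module.Finite k (M ⧸ mM)]
    (φ : Module.End R M) (hφ : ∀ i : ℕ, ∀ x ∈ ℳ i, φ x ∈ ℳ i)
    (A : Module.End k (M ⧸ mM))
    (hA : ∀ x : M, A (Submodule.Quotient.mk x) = Submodule.Quotient.mk (φ x)) :
    aeval φ A.charpoly = 0 := by
  let W : ℕ → Submodule k (M ⧸ mM) := fun d => ((auxN R ℳ d).map mM.mkQ).restrictScalars k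
  have hW : ∀ d, ∀ x ∈ W d, A x ∈ W d := by
    rintro d _ ⟨x, hx, rfl⟩
    exact ⟨φ x, auxN_map ℳ φ hφ d x hx, (hA x).symm⟩
  have key : ∀ d, ∀ x ∈ auxN R ℳ d, aeval φ (A.restrict (hW d)).charpoly x = 0 := by
    intro d
    induction d with
    | zero =>
      intro x hx
      have : x = 0 := by simpa [auxN] using hx
      rw [this, map_zero]
    | succ d ih =>
      have hle : W d ≤ W (d + 1) := by
        rintro _ ⟨x, hx, rfl⟩
        exact ⟨x, auxN_mono ℳ (Nat.le_succ d) hx, rfl⟩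
      obtain ⟨q, hq, hqW⟩ := aux_step (W d) (W (d + 1)) hle A (hW d) (hW (d + 1))
      intro x hx
      rw [hq, map_mul, Module.End.mul_apply]
      apply ih
      have : auxN R ℳ (d + 1) ≤ (auxN R ℳ d).comap (aeval φ q) := by
        refine Submodule.span_le.2 ?_
        clear x hx
        rintro x ⟨i, hi, hx⟩
        have hmem := aux_aeval_mem ℳ φ hφ q i x hx
        rcases Nat.lt_succ_iff_lt_or_eq.1 hi with hi' | rfl
        · exact Submodule.subset_span ⟨i, hi', hmem⟩
        · have h1 : (Submodule.Quotient.mk x : M ⧸ mM) ∈ W (i + 1) :=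
            ⟨x, Submodule.subset_span ⟨i, hi, hx⟩, rfl⟩
          have h2 := hqW _ h1
          rw [aux_mk_aeval mM φ A hA] at h2
          obtain ⟨z, hz, hzy⟩ := h2
          have h3 : aeval φ q x - z ∈ mM := (Submodule.Quotient.eq mM).1 hzy.symm
          have h4 : aeval φ q x ∈ auxN R ℳ i ⊔ mM :=
            Submodule.mem_sup.2 ⟨z, hz, _, h3, by abel⟩
          rw [hmM] at h4
          have h5 := aux_comp_mem 𝒜 ℳ i _ h4
          rwa [DirectSum.decompose_of_mem_same ℳ hmem] at h5
      exact this hx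
  obtain ⟨D, hD⟩ := auxN_top (R := R) ℳ
  ext x
  rw [aux_charpoly_mul (W D) A (hW D), mul_comm, map_mul, Module.End.mul_apply,
    LinearMap.zero_apply, key D x (hD ▸ trivial), map_zero]

end aux


/-- Let `k` be a field, `R` a commutative ℕ-graded ring with `R₀ = k`,
finitely generated as a `k`-algebra, `𝔪` its irrelevant maximal ideal, and `M` a nonzero
finitely generated graded `R`-module. Let `φ` be a degree-zero endomorphism of `M`, and let
`λ₁, …, λ_r ∈ k` be distinct eigenvalues of the induced map `A` on `M/𝔪M`, with algebraic
multiplicities `μ₁, …, μ_r`. Set `ψ j = (φ - λ j·id)^(μ j)` and `Ψ = ψ 1 ∘ ⋯ ∘ ψ r`. Then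
`M = ker ψ₁ ⊕ ⋯ ⊕ ker ψ_r ⊕ im Ψ` as an internal direct sum of graded submodules, with each
`ker ψ j ≠ 0`. -/
theorem statement_5 {k R M : Type*} [Field k] [CommRing R] [Algebra k R]
    (𝒜 : ℕ → Submodule k R) [GradedAlgebra 𝒜]
    (h0 : ∀ x ∈ 𝒜 0, ∃ c : k, algebraMap k R c = x)
    (hFT : Algebra.FiniteType k R)
    [AddCommGroup M] [Module k M] [Module R M] [IsScalarTower k R M]
    [Module.Finite R M] [Nontrivial M]
    (ℳ : ℕ → Submodule k M) [SetLike.GradedSMul 𝒜 ℳ] [DirectSum.Decomposition ℳ]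
    (mM : Submodule R M) (hmM : mM = (HomogeneousIdeal.irrelevant 𝒜).toIdeal • ⊤)
    [Module.Finite k (M ⧸ mM)]
    (φ : Module.End R M) (hφ : ∀ i : ℕ, ∀ x ∈ ℳ i, φ x ∈ ℳ i)
    (A : Module.End k (M ⧸ mM))
    (hA : ∀ x : M, A (Submodule.Quotient.mk x) = Submodule.Quotient.mk (φ x))
    {r : ℕ} (lam : Fin r → k) (hinj : Function.Injective lam)
    (hlam : ∀ j, Module.End.HasEigenvalue A (lam j))
    (μ : Fin r → ℕ) (hμ : ∀ j, μ j = (LinearMap.charpoly A).rootMultiplicity (lam j))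
    (ψ : Fin r → Module.End R M)
    (hψ : ∀ j, ψ j = (φ - algebraMap k R (lam j) • 1) ^ (μ j)) :
    DirectSum.IsInternal (fun o : Option (Fin r) =>
      Option.elim o (LinearMap.range ((List.ofFn ψ).prod)) (fun j => LinearMap.ker (ψ j))) ∧
    (∀ j, LinearMap.ker (ψ j) ≠ ⊥) ∧
    (∀ o : Option (Fin r), ∀ x ∈ Option.elim o (LinearMap.range ((List.ofFn ψ).prod))
        (fun j => LinearMap.ker (ψ j)), ∀ i : ℕ,
      (DirectSum.decompose ℳ x i : M) ∈ Option.elim o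
        (LinearMap.range ((List.ofFn ψ).prod)) (fun j => LinearMap.ker (ψ j))) := by
  classical
  have hP := aux_cayley 𝒜 ℳ mM hmM φ hφ A hA
  set P := A.charpoly with hPdef
  have hP0 : P ≠ 0 := A.charpoly_monic.ne_zero
  let p : Fin r → Polynomial k := fun j => (Polynomial.X - Polynomial.C (lam j)) ^ (μ j)
  have hψp : ∀ j, ψ j = Polynomial.aeval φ (p j) := by
    intro j
    rw [hψ, map_pow, map_sub, Polynomial.aeval_X, Polynomial.aeval_C,
      Algebra.algebraMap_eq_smul_one (A := Module.End R M), algebraMap_smul]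
  have hΨ : (List.ofFn ψ).prod = Polynomial.aeval φ (∏ j, p j) := by
    rw [← List.prod_ofFn, map_list_prod, List.map_ofFn]
    congr 2
    funext j
    exact hψp j
  have hcop : Pairwise (Function.onFun IsCoprime p) := fun i j hij =>
    (Polynomial.pairwise_coprime_X_sub_C hinj hij).pow
  have hpP : ∀ j, p j ∣ P := fun j => by
    simp only [p, hμ]
    exact Polynomial.pow_rootMultiplicity_dvd P (lam j)
  obtain ⟨Q, hQ⟩ := Fintype.prod_dvd_of_coprime hcop hpP
  have hcopQ : ∀ j, IsCoprime (p j) Q := by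
    intro j
    refine IsCoprime.pow_left ?_
    rw [(Polynomial.irreducible_X_sub_C (lam j)).coprime_iff_not_dvd]
    rintro hd
    refine Polynomial.pow_rootMultiplicity_not_dvd hP0 (lam j) ?_
    rw [← hμ, pow_succ, hQ]
    exact mul_dvd_mul (Finset.dvd_prod_of_mem p (Finset.mem_univ j)) hd
  let s : Option (Fin r) → Polynomial k := fun o => o.elim Q p
  have hs : Pairwise (Function.onFun IsCoprime s) := by
    rintro (_ | i) (_ | j) hij
    · exact absurd rfl hij
    · exact (hcopQ j).symm
    · exact hcopQ i
    · exact hcop fun h => hij (congrArg some h)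
  have hsP : ∏ o, s o = P := by
    rw [Fintype.prod_option, hQ, mul_comm]
    rfl
  obtain ⟨ν, hν⟩ := exists_sum_eq_one_iff_pairwise_coprime'.2 hs
  set e : Option (Fin r) → Polynomial k := fun i => ν i * ∏ j ∈ {i}ᶜ, s j with he
  have hse : ∀ i, P ∣ s i * e i := by
    intro i
    refine ⟨ν i, ?_⟩
    rw [← hsP, ← Finset.prod_mul_prod_compl {i}, Finset.prod_singleton]
    simp only [he]
    ring
  have hdvd : ∀ i j, i ≠ j → s j ∣ e i := by
    intro i j hij
    exact Dvd.dvd.mul_left (Finset.dvd_prod_of_mem s (by simpa using hij.symm)) _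
  have hkill : ∀ q, P ∣ q → Polynomial.aeval φ q = 0 := by
    rintro _ ⟨c, rfl⟩
    rw [map_mul, hP, zero_mul]
  have hE1 : ∀ i x, Polynomial.aeval φ (e i) x ∈ Option.elim i
      (LinearMap.range ((List.ofFn ψ).prod)) (fun j => LinearMap.ker (ψ j)) := by
    rintro (_ | j) x
    · have : (∏ j, p j) ∣ e none :=
        Fintype.prod_dvd_of_coprime hcop fun j => hdvd none (some j) (by simp)
      obtain ⟨c, hc⟩ := this
      refine ⟨Polynomial.aeval φ c x, ?_⟩
      rw [hΨ, hc, map_mul, Module.End.mul_apply]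
    · change _ ∈ LinearMap.ker (ψ j)
      rw [LinearMap.mem_ker, hψp, ← Module.End.mul_apply, ← map_mul, hkill (p j * e (some j)) (hse (some j)),
        LinearMap.zero_apply]
  refine ⟨?_, ?_, ?_⟩
  · refine aux_internal _ (fun i => Polynomial.aeval φ (e i)) ?_ hE1 ?_
    · rw [← map_sum, hν, map_one]
    · rintro i (_ | j) hij x hx
      · obtain ⟨y, rfl⟩ := hx
        rw [hΨ, ← Module.End.mul_apply, ← map_mul, hkill, LinearMap.zero_apply]
        rw [hQ, mul_comm (e i)]
        exact mul_dvd_mul_left _ (hdvd i none hij)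
      · have hx' : ψ j x = 0 := hx
        obtain ⟨c, hc⟩ := hdvd i (some j) hij
        change Polynomial.aeval φ (e i) x = 0
        rw [hc, mul_comm, map_mul, Module.End.mul_apply]
        change Polynomial.aeval φ c (Polynomial.aeval φ (p j) x) = 0
        rw [← hψp, hx', map_zero]
  · intro j hbot
    have hej : Polynomial.aeval φ (e (some j)) = 0 := by
      ext x
      have : Polynomial.aeval φ (e (some j)) x ∈ LinearMap.ker (ψ j) := hE1 (some j) x
      rw [hbot] at this
      simpa using this
    obtain ⟨v, hv⟩ := (hlam j).exists_hasEigenvector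
    have h1 : Polynomial.aeval A (e (some j)) v = 0 := by
      obtain ⟨x, rfl⟩ := Submodule.Quotient.mk_surjective _ v
      rw [aux_mk_aeval mM φ A hA, hej]
      rfl
    rw [Module.End.aeval_apply_of_hasEigenvector hv] at h1
    have h2 : (e (some j)).eval (lam j) = 0 := (smul_eq_zero.1 h1).resolve_right hv.2
    have hμ0 : μ j ≠ 0 := by
      rw [hμ]
      have : P.IsRoot (lam j) := (Module.End.hasEigenvalue_iff_isRoot_charpoly A (lam j)).1 (hlam j)
      exact ((Polynomial.rootMultiplicity_pos hP0).2 this).ne'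
    have h3 := congrArg (Polynomial.eval (lam j)) hν
    rw [Polynomial.eval_finsetSum, Finset.sum_eq_zero, Polynomial.eval_one] at h3
    · exact zero_ne_one h3
    · intro i _
      by_cases hi : i = some j
      · rw [hi]; exact h2
      · obtain ⟨c, hc⟩ := hdvd i (some j) hi
        change (e i).eval (lam j) = 0
        rw [hc, Polynomial.eval_mul]
        simp [s, p, hμ0]
  · have hcomm : ∀ (q : Polynomial k) (x : M) (i : ℕ),
        (DirectSum.decompose ℳ (Polynomial.aeval φ q x) i : M) =
          Polynomial.aeval φ q (DirectSum.decompose ℳ x i) := fun q =>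
      aux_decompose ℳ _ (aux_aeval_mem ℳ φ hφ q)
    rintro (_ | j) x hx i
    · obtain ⟨y, rfl⟩ := hx
      rw [hΨ, hcomm]
      exact ⟨_, rfl⟩
    · have hx' : ψ j x = 0 := hx
      change ψ j _ = 0
      rw [hψp] at hx' ⊢
      rw [← hcomm, hx']
      simp
end

section
/- Let k be a field, let m ≥ 1, r ≥ 1 be integers, and let A_1, …, A_r ∈ Mat_m(k). Then there exist finitely many homogeneous polynomials f_1, …, f_s ∈ k[x_1, …, x_r], each of degree at most m, such that for every α = (α_1, …, α_r) in an algebraic closure K of k, the matrix Σ_i α_i A_i has exactly one eigenvalue in K (equivalently, its characteristic polynomial is of the form (λ − y)^m for some y ∈ K) if and only if f_j(α) = 0 for all j. Moreover, if there exists β ∈ k^r such that Σ_i β_i A_i has at least two distinct eigenvalues in K, then the f_j are not all the zero polynomial; in particular the set of α with at least two distinct eigenvalues is a nonempty Zariski-open subset of affine r-space. -/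
open Polynomial in
theorem aux_decomp (k : Type*) [Field k] (p : ℕ) [hp : ExpChar k p] (m : ℕ) (hm : 1 ≤ m) :
    ∃ e n : ℕ, m = p ^ e * n ∧ (n : k) ≠ 0 := by
  cases hp with
  | zero => exact ⟨0, m, by simp, by exact_mod_cast (by omega : m ≠ 0)⟩
  | prime hpp =>
    obtain ⟨e, n, hn, h⟩ := Nat.exists_eq_pow_mul_and_not_dvd (by omega : m ≠ 0) p hpp.ne_one
    exact ⟨e, n, h, fun h0 => hn ((CharP.cast_eq_zero_iff k p n).1 h0)⟩

open Polynomial in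
theorem aux_iff {K : Type*} [Field K] [IsAlgClosed K] (p e n m : ℕ) [ExpChar K p]
    (hm : m = p ^ e * n) (hn : (n : K) ≠ 0) (P : K[X]) :
    (∃ y : K, P = (X - C y) ^ m) ↔
      P = expand K (p ^ e) ((X + C ((n : K)⁻¹ * P.coeff (m - p ^ e))) ^ n) := by
  have hq : 0 < p ^ e := pow_pos (expChar_pos K p) e
  have key : ∀ y : K, (X - C y) ^ m = expand K (p ^ e) ((X + C (-(y ^ p ^ e))) ^ n) := by
    intro y
    rw [hm, pow_mul, sub_pow_expChar_pow]
    simp [sub_eq_add_neg]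
  have hn0 : n ≠ 0 := by rintro rfl; simp at hn
  constructor
  · rintro ⟨y, rfl⟩
    have h1 : m - p ^ e = p ^ e * (n - 1) := by rw [hm, Nat.mul_sub, mul_one]
    have : (n : K)⁻¹ * ((X - C y) ^ m).coeff (m - p ^ e) = -(y ^ p ^ e) := by
      rw [key, h1, coeff_expand_mul' hq, coeff_X_add_C_pow,
        Nat.sub_sub_self (by omega), Nat.choose_symm (by omega : 1 ≤ n)]
      simp
      field_simp
    rw [this, key]
  · intro h
    obtain ⟨y, hy⟩ := IsAlgClosed.exists_pow_nat_eq
      (-((n : K)⁻¹ * P.coeff (m - p ^ e))) hq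
    refine ⟨y, ?_⟩
    rw [key, hy, neg_neg]
    exact h

open Polynomial in
theorem aux_deg {R : Type*} [CommRing R] (q n : ℕ) (b : R) :
    (expand R q ((X + C b) ^ n)).natDegree ≤ q * n := by
  rw [natDegree_expand, mul_comm]
  refine Nat.mul_le_mul_left _ (natDegree_pow_le_of_le n (natDegree_add_C.trans_le natDegree_X_le) |>.trans ?_)
  simp

/-- The generic linear combination. -/
noncomputable def auxG {k : Type*} [Field k] {m r : ℕ} (A : Fin r → Matrix (Fin m) (Fin m) k) :
    Matrix (Fin m) (Fin m) (MvPolynomial (Fin r) k) :=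
  Matrix.of fun a b => ∑ i, MvPolynomial.X i * MvPolynomial.C (A i a b)

theorem auxG_hom {k : Type*} [Field k] {m r : ℕ} (A : Fin r → Matrix (Fin m) (Fin m) k)
    (i j : ℕ) (h : i + j = m) : ((auxG A).charpoly.coeff i).IsHomogeneous j := by
  have h1 := Matrix.charpoly.univ_coeff_isHomogeneous (R := k) (Fin m) i j (by simpa using h)
  have h2 := h1.aeval (n := 1) (S := k) (fun ab : Fin m × Fin m => auxG A ab.1 ab.2) (by
    intro ab
    change (∑ i, MvPolynomial.X i * MvPolynomial.C (A i ab.1 ab.2) :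
      MvPolynomial (Fin r) k).IsHomogeneous 1
    refine MvPolynomial.IsHomogeneous.sum _ _ _ fun i _ => ?_
    exact (MvPolynomial.isHomogeneous_X k i).mul (MvPolynomial.isHomogeneous_C _ _))
  have h3 := Matrix.charpoly.univ_coeff_eval₂Hom (Fin m)
    (algebraMap k (MvPolynomial (Fin r) k)) (fun ab : Fin m × Fin m => auxG A ab.1 ab.2) i
  rw [one_mul] at h2
  have h4 : (Matrix.of (Function.curry fun ab : Fin m × Fin m => auxG A ab.1 ab.2)) = auxG A := rfl
  rw [h4] at h3
  rw [← h3]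
  exact h2

theorem auxG_map {k K : Type*} [Field k] [Field K] [Algebra k K] {m r : ℕ}
    (A : Fin r → Matrix (Fin m) (Fin m) k) (α : Fin r → K) :
    (auxG A).charpoly.map (MvPolynomial.aeval α : MvPolynomial (Fin r) k →ₐ[k] K).toRingHom =
      Matrix.charpoly (∑ i, α i • (A i).map (algebraMap k K)) := by
  rw [← Matrix.charpoly_map]
  congr 1
  ext a b
  simp [auxG, Matrix.sum_apply]


/-- Let `k` be a field, `m, r ≥ 1`, and `A₁, …, A_r ∈ Mat_m(k)`. Then there
are finitely many homogeneous polynomials `f₁, …, f_s ∈ k[x₁,…,x_r]`, each of degree at most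
`m`, such that for every `α` in (an) algebraic closure `K` of `k`, the matrix `Σ αᵢ Aᵢ` has
exactly one eigenvalue in `K` (equivalently, its characteristic polynomial is `(λ - y)^m` for
some `y ∈ K`) iff `f_j(α) = 0` for all `j`. Moreover, if some `β ∈ k^r` makes `Σ βᵢ Aᵢ` have
at least two distinct eigenvalues in `K`, then the `f_j` are not all zero (so the locus of
`α` with at least two distinct eigenvalues is a nonempty Zariski-open subset of `𝔸^r`). -/
theorem statement_14 {k : Type*} [Field k] (m r : ℕ) (hm : 1 ≤ m) (hr : 1 ≤ r)
    (A : Fin r → Matrix (Fin m) (Fin m) k) :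
    ∃ (s : ℕ) (f : Fin s → MvPolynomial (Fin r) k),
      (∀ j, ∃ d : ℕ, d ≤ m ∧ (f j).IsHomogeneous d) ∧
      (∀ α : Fin r → AlgebraicClosure k,
        ((∃ y : AlgebraicClosure k,
            Matrix.charpoly (∑ i, α i • (A i).map (algebraMap k (AlgebraicClosure k)))
              = (Polynomial.X - Polynomial.C y) ^ m) ↔
          ∀ j, MvPolynomial.aeval α (f j) = 0)) ∧
      ((∃ β : Fin r → k, ∃ y₁ y₂ : AlgebraicClosure k, y₁ ≠ y₂ ∧
          Polynomial.aeval y₁ (Matrix.charpoly (∑ i, β i • A i)) = 0 ∧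
          Polynomial.aeval y₂ (Matrix.charpoly (∑ i, β i • A i)) = 0) →
        ∃ j, f j ≠ 0) := by
  classical
  obtain ⟨p, hp⟩ := ExpChar.exists k
  obtain ⟨e, n, hmn, hn⟩ := aux_decomp k p m hm
  have hq : 0 < p ^ e := pow_pos (expChar_pos k p) e
  have hpK : ExpChar (AlgebraicClosure k) p :=
    expChar_of_injective_algebraMap (algebraMap k (AlgebraicClosure k)).injective p
  have hnK : (n : AlgebraicClosure k) ≠ 0 := by
    intro h
    apply hn
    apply (algebraMap k (AlgebraicClosure k)).injective
    simpa using h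
  have hn0 : 1 ≤ n := by
    rcases Nat.eq_zero_or_pos n with h | h
    · simp [h] at hn
    · exact h
  have hqm : p ^ e ≤ m := by rw [hmn]; exact Nat.le_mul_of_pos_right _ hn0
  set P := (auxG A).charpoly with hP
  set b : MvPolynomial (Fin r) k := MvPolynomial.C ((n : k)⁻¹) * P.coeff (m - p ^ e) with hb
  set Q := Polynomial.expand _ (p ^ e) ((Polynomial.X + Polynomial.C b) ^ n) with hQ
  have hbh : b.IsHomogeneous (p ^ e) := by
    have := (MvPolynomial.isHomogeneous_C (Fin r) ((n : k)⁻¹)).mul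
      (auxG_hom A (m - p ^ e) (p ^ e) (by omega))
    rwa [zero_add] at this
  have hiff : ∀ α : Fin r → AlgebraicClosure k,
        ((∃ y : AlgebraicClosure k,
            Matrix.charpoly (∑ i, α i • (A i).map (algebraMap k (AlgebraicClosure k)))
              = (Polynomial.X - Polynomial.C y) ^ m) ↔
          ∀ j : Fin (m + 1), MvPolynomial.aeval α (P.coeff j - Q.coeff j) = 0) := by
    intro α
    have hPm := auxG_map A α
    rw [← hP] at hPm
    have hQm : Q.map (MvPolynomial.aeval α :
        MvPolynomial (Fin r) k →ₐ[k] AlgebraicClosure k).toRingHom =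
        Polynomial.expand _ (p ^ e) ((Polynomial.X + Polynomial.C ((n : AlgebraicClosure k)⁻¹ *
          (Matrix.charpoly (∑ i, α i • (A i).map
            (algebraMap k (AlgebraicClosure k)))).coeff (m - p ^ e))) ^ n) := by
      rw [← hPm, hQ, Polynomial.map_expand]
      simp [hb]
    rw [aux_iff p e n m hmn hnK, ← hQm]
    rw [Polynomial.ext_iff_natDegree_le (n := m)]
    · rw [← hPm]
      simp only [Polynomial.coeff_map]
      constructor
      · intro h j
        rw [map_sub, sub_eq_zero]
        exact h j (by omega)
      · intro h i hi
        have := h ⟨i, by omega⟩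
        rw [map_sub, sub_eq_zero] at this
        exact this
    · rw [Matrix.charpoly_natDegree_eq_dim]; simp
    · rw [hQm]; exact (aux_deg _ _ _).trans hmn.ge
  refine ⟨m + 1, fun j => P.coeff j - Q.coeff j, ?_, hiff, ?_⟩
  · intro j
    have hj : (j : ℕ) ≤ m := by omega
    refine ⟨m - j, by omega, (auxG_hom A j (m - j) (by omega)).sub ?_⟩
    rw [hQ, Polynomial.coeff_expand hq]
    split_ifs with hd
    · obtain ⟨t, ht⟩ := hd
      rw [ht, Nat.mul_div_cancel_left _ hq, Polynomial.coeff_X_add_C_pow, hmn, ← Nat.mul_sub]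
      have := (hbh.pow (n - t)).mul (MvPolynomial.isHomogeneous_C (Fin r) ((n.choose t : ℕ) : k))
      simpa using this
    · exact MvPolynomial.isHomogeneous_zero _ _ _
  · rintro ⟨β, y₁, y₂, hne, h1, h2⟩
    by_contra hcon
    push Not at hcon
    obtain ⟨y, hy⟩ := (hiff (fun i => algebraMap k _ (β i))).2 (fun j => by
      have := hcon j
      rw [this, map_zero])
    have hc : (∑ i, algebraMap k (AlgebraicClosure k) (β i) •
        (A i).map (algebraMap k (AlgebraicClosure k))) =
        (∑ i, β i • A i).map (algebraMap k (AlgebraicClosure k)) := by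
      ext a b
      simp only [Matrix.sum_apply, Matrix.smul_apply, Matrix.map_apply, smul_eq_mul, map_sum,
        map_mul]
    have hc2 := Matrix.charpoly_map (∑ i, β i • A i) (algebraMap k (AlgebraicClosure k))
    rw [hc] at hy
    rw [hy] at hc2
    have hroot : ∀ z : AlgebraicClosure k,
        Polynomial.aeval z (Matrix.charpoly (∑ i, β i • A i)) = 0 → z = y := by
      intro z hz
      rw [Polynomial.aeval_def, ← Polynomial.eval_map, ← hc2] at hz
      simp only [Polynomial.eval_pow, Polynomial.eval_sub, Polynomial.eval_X,
        Polynomial.eval_C] at hz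
      exact sub_eq_zero.1 (pow_eq_zero_iff (by omega) |>.1 hz)
    exact hne ((hroot _ h1).trans (hroot _ h2).symm)
end

section
/- Let k be a finite field with q elements, let m ≥ 1, r ≥ 1 be integers, and let A_1, …, A_r ∈ Mat_m(k). Suppose there exists β ∈ k^r such that Σ_i β_i A_i has at least two distinct eigenvalues in an algebraic closure of k. Then the number of nonzero tuples α ∈ k^r \ {0} for which Σ_i α_i A_i has exactly one eigenvalue in the algebraic closure of k is at most m·(q^{r−1} − 1); equivalently, the proportion of points of P^{r−1}(k) whose representatives α give Σ_i α_i A_i at least two distinct eigenvalues is at least 1 − m·(q^{r−1} − 1)/(q^r − 1). -/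
open Polynomial in
lemma s15_prod {σ k : Type*} [Field k] (u v : σ → k) (e : σ → ℕ) (s : Finset σ) :
    (∏ i ∈ s, (C (v i) * X + C (u i)) ^ e i : k[X]).natDegree ≤ ∑ i ∈ s, e i ∧
    (∏ i ∈ s, (C (v i) * X + C (u i)) ^ e i : k[X]).coeff (∑ i ∈ s, e i) = ∏ i ∈ s, v i ^ e i := by
  classical
  induction s using Finset.induction_on with
  | empty => simp
  | insert a s ha ih =>
    rw [Finset.prod_insert ha, Finset.sum_insert ha, Finset.prod_insert ha]
    have h1 : (C (v a) * X + C (u a) : k[X]).natDegree ≤ 1 := natDegree_linear_le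
    have h2 : ((C (v a) * X + C (u a)) ^ e a : k[X]).natDegree ≤ e a := by
      simpa using natDegree_pow_le_of_le (e a) h1
    refine ⟨natDegree_mul_le_of_le h2 ih.1, ?_⟩
    rw [coeff_mul_add_eq_of_natDegree_le h2 ih.1, ih.2]
    congr 1
    have := coeff_pow_of_natDegree_le (m := e a) h1
    simpa using this

open Polynomial in
lemma s15_line {σ k : Type*} [Field k] (G : MvPolynomial σ k) (d : ℕ)
    (hG : G.IsHomogeneous d) (u v : σ → k) :
    (MvPolynomial.aeval (fun i => (C (v i) * X + C (u i) : k[X])) G).natDegree ≤ d ∧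
    (MvPolynomial.aeval (fun i => (C (v i) * X + C (u i) : k[X])) G).coeff d
      = MvPolynomial.eval v G := by
  classical
  have hd : ∀ e ∈ G.support, ∑ i ∈ e.support, e i = d := by
    intro e he
    have := hG (MvPolynomial.mem_support_iff.1 he)
    rw [Finsupp.weight_apply] at this
    simpa [Finsupp.sum] using this
  rw [MvPolynomial.aeval_def, MvPolynomial.eval₂_eq, MvPolynomial.eval_eq]
  constructor
  · refine natDegree_sum_le_of_forall_le _ _ fun e he => ?_
    have := (s15_prod u v e e.support).1
    rw [hd e he] at this
    exact (natDegree_C_mul_le _ _).trans this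
  · rw [finset_sum_coeff]
    refine Finset.sum_congr rfl fun e he => ?_
    have := (s15_prod u v e e.support).2
    rw [hd e he] at this
    rw [← this]
    exact coeff_C_mul _

lemma s15_smul {σ k : Type*} [Field k] (G : MvPolynomial σ k) (d : ℕ)
    (hG : G.IsHomogeneous d) (c : k) (v : σ → k) :
    MvPolynomial.eval (fun i => c * v i) G = c ^ d * MvPolynomial.eval v G := by
  rw [MvPolynomial.eval_eq, MvPolynomial.eval_eq, Finset.mul_sum]
  refine Finset.sum_congr rfl fun e he => ?_
  have := hG (MvPolynomial.mem_support_iff.1 he)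
  rw [Finsupp.weight_apply] at this
  have h : ∑ i ∈ e.support, e i = d := by simpa [Finsupp.sum] using this
  rw [← h, ← Finset.prod_pow_eq_pow_sum]
  simp only [mul_pow, Finset.prod_mul_distrib]
  ring

/-- counting zeros of a homogeneous form on a linear image of `k^r` -/
lemma s15_count {σ k : Type*} [Field k] [Fintype k] (m r d : ℕ) (hd : d ≤ m)
    (L : (Fin r → k) →ₗ[k] (σ → k)) (G : MvPolynomial σ k)
    (hG : G.IsHomogeneous d) (β : Fin r → k) (hβ0 : β ≠ 0) (hβ : MvPolynomial.eval (L β) G ≠ 0)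
    (S : Set (Fin r → k)) (hS : ∀ α ∈ S, α ≠ 0 ∧ MvPolynomial.eval (L α) G = 0) :
    S.ncard ≤ m * (Fintype.card k ^ (r - 1) - 1) := by
  classical
  let W := Submodule.span k {β}
  haveI : Fintype ((Fin r → k) ⧸ W) := Fintype.ofFinite _
  have hcard : Fintype.card ((Fin r → k) ⧸ W) = Fintype.card k ^ (r - 1) := by
    rw [Module.card_eq_pow_finrank (K := k), Submodule.finrank_quotient, finrank_span_singleton hβ0]
    simp
  rw [Set.ncard_eq_toFinset_card' S]
  have key := Finset.card_le_mul_card_image_of_maps_to (f := W.mkQ) (s := S.toFinset)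
    (t := Finset.univ.erase 0) ?_ m ?_
  · rwa [Finset.card_erase_of_mem (Finset.mem_univ _), Finset.card_univ, hcard] at key
  · intro α hα
    obtain ⟨h0, h1⟩ := hS α (by simpa using hα)
    simp only [Finset.mem_erase, Finset.mem_univ, and_true]
    intro h
    rw [Submodule.mkQ_apply, Submodule.Quotient.mk_eq_zero, Submodule.mem_span_singleton] at h
    obtain ⟨c, rfl⟩ := h
    have hc : c ≠ 0 := by rintro rfl; simp at h0
    have e : L (c • β) = fun i => c * L β i := by ext i; simp
    rw [e, s15_smul G d hG] at h1
    exact mul_ne_zero (pow_ne_zero _ hc) hβ h1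
  · intro b _
    obtain ⟨u, rfl⟩ := W.mkQ_surjective b
    obtain ⟨hl1, hl2⟩ := s15_line G d hG (L u) (L β)
    set g := (MvPolynomial.aeval
      (fun i => (Polynomial.C (L β i) * Polynomial.X + Polynomial.C (L u i) : Polynomial k)) G)
      with hg
    have hg0 : g ≠ 0 := by
      intro h
      rw [h] at hl2
      exact hβ (by rw [← hl2]; simp)
    have hev : ∀ t, g.eval t = MvPolynomial.eval (L (u + t • β)) G := by
      intro t
      rw [hg, ← Polynomial.coe_aeval_eq_eval, ← AlgHom.comp_apply, ← MvPolynomial.aeval_eq_eval]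
      congr 1
      ext i
      simp
      ring
    calc _ ≤ (g.roots.toFinset.image (fun t => u + t • β)).card := by
          apply Finset.card_le_card
          intro α hα
          simp only [Finset.mem_filter, Set.mem_toFinset] at hα
          obtain ⟨ha, hb⟩ := hα
          rw [Submodule.mkQ_apply, Submodule.mkQ_apply, Submodule.Quotient.eq,
            Submodule.mem_span_singleton] at hb
          obtain ⟨t, ht⟩ := hb
          have e : u + t • β = α := by rw [ht]; abel
          simp only [Finset.mem_image, Multiset.mem_toFinset]
          refine ⟨t, ?_, e⟩
          rw [Polynomial.mem_roots hg0, Polynomial.IsRoot, hev, e]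
          exact (hS α ha).2
      _ ≤ g.roots.toFinset.card := Finset.card_image_le
      _ ≤ Multiset.card g.roots := Multiset.toFinset_card_le _
      _ ≤ g.natDegree := Polynomial.card_roots' _
      _ ≤ m := hl1.trans hd

open Polynomial in
lemma s15_coeff {K : Type*} [Field K] (P s : ℕ) (hP : 0 < P) (a : K) (i : ℕ) :
    ((X ^ P + C a) ^ s : K[X]).coeff i =
      if P ∣ i then a ^ (s - i / P) * (s.choose (i / P) : K) else 0 := by
  have : ((X ^ P + C a) ^ s : K[X]) = expand K P ((X + C a) ^ s) := by simp
  rw [this, coeff_expand hP]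
  simp [coeff_X_add_C_pow]

/-- the obstruction forms -/
noncomputable def s15G (k : Type*) [Field k] (m P s i : ℕ) : MvPolynomial (Fin m × Fin m) k :=
  (Matrix.charpoly.univ k (Fin m)).coeff i -
    if P ∣ i then MvPolynomial.C (s.choose (i / P) : k) *
      (MvPolynomial.C ((s : k)⁻¹) * (Matrix.charpoly.univ k (Fin m)).coeff (m - P)) ^ (s - i / P)
    else 0

lemma s15G_hom (k : Type*) [Field k] (m P s i : ℕ) (hP : 0 < P) (hs : 0 < s) (h : m = P * s)
    (hi : i ≤ m) : (s15G k m P s i).IsHomogeneous (m - i) := by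
  have hle : P ≤ m := by rw [h]; exact Nat.le_mul_of_pos_right _ hs
  refine MvPolynomial.IsHomogeneous.sub ?_ ?_
  · exact Matrix.charpoly.univ_coeff_isHomogeneous _ _ _ _ (by simp; omega)
  · split_ifs with hd
    · have h1 : ((Matrix.charpoly.univ k (Fin m)).coeff (m - P)).IsHomogeneous P :=
        Matrix.charpoly.univ_coeff_isHomogeneous _ _ _ _ (by simp; omega)
      have h2 := ((h1.C_mul ((s : k)⁻¹)).pow (s - i / P)).C_mul (s.choose (i / P) : k)
      have e : P * (s - i / P) = m - i := by
        rw [Nat.mul_sub, Nat.mul_div_cancel' hd, h]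
      rwa [e] at h2
    · exact MvPolynomial.isHomogeneous_zero _ _ _

lemma s15G_eval {k : Type*} [Field k] (m P s i : ℕ) (hP : 0 < P) (M : Matrix (Fin m) (Fin m) k) :
    MvPolynomial.eval (fun ij : Fin m × Fin m => M ij.1 ij.2) (s15G k m P s i) =
      M.charpoly.coeff i -
       ((Polynomial.X ^ P + Polynomial.C ((s : k)⁻¹ * M.charpoly.coeff (m - P))) ^ s).coeff i := by
  have h : ∀ j, MvPolynomial.eval (fun ij : Fin m × Fin m => M ij.1 ij.2)
      ((Matrix.charpoly.univ k (Fin m)).coeff j) = M.charpoly.coeff j := by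
    intro j
    exact Matrix.charpoly.univ_coeff_eval₂Hom (Fin m) (RingHom.id k)
      (fun ij : Fin m × Fin m => M ij.1 ij.2) j
  rw [s15_coeff P s hP, s15G, map_sub, h]
  congr 1
  split_ifs
  · simp only [map_mul, map_pow, MvPolynomial.eval_C, h]
    ring
  · simp

open Polynomial in
lemma s15_unique {k : Type*} [Field k] (p e m s : ℕ) [Fact p.Prime] [CharP k p]
    (hs : ¬ p ∣ s) (h : m = p ^ e * s) (f : k[X]) (hf : f.Monic) (hfd : f.natDegree = m)
    (hu : ∃! y : AlgebraicClosure k, aeval y f = 0) :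
    f = (X ^ (p ^ e) + C ((s : k)⁻¹ * f.coeff (m - p ^ e))) ^ s := by
  obtain ⟨y, hy, hy'⟩ := hu
  have hP : 0 < p ^ e := pow_pos (Fact.out : p.Prime).pos _
  have hs0 : 0 < s := Nat.pos_of_ne_zero (by rintro rfl; simp at hs)
  have hsk : (s : k) ≠ 0 := by rwa [Ne, CharP.cast_eq_zero_iff k p]
  haveI : CharP (AlgebraicClosure k) p := charP_of_injective_algebraMap
    (algebraMap k (AlgebraicClosure k)).injective p
  set F := f.map (algebraMap k (AlgebraicClosure k)) with hF
  have hFm : F.Monic := hf.map _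
  have hsp : F.Splits := IsAlgClosed.splits F
  have hroots : F.roots = Multiset.replicate m y := by
    rw [Multiset.eq_replicate]
    constructor
    · rw [← hfd, ← hsp.natDegree_eq_card_roots, hF, natDegree_map]
    · intro b hb
      apply hy'
      rw [mem_roots hFm.ne_zero, IsRoot, hF, eval_map_algebraMap] at hb
      exact hb
  have h1 : F = (X ^ (p ^ e) + C (-(y ^ (p ^ e)))) ^ s := by
    rw [hsp.eq_prod_roots_of_monic hFm, hroots]
    simp only [Multiset.map_replicate, Multiset.prod_replicate]
    rw [h, pow_mul, sub_pow_char_pow]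
    simp [sub_eq_add_neg]
  have h2 : algebraMap k (AlgebraicClosure k) ((s : k)⁻¹ * f.coeff (m - p ^ e))
      = -(y ^ (p ^ e)) := by
    have h3 : F.coeff (m - p ^ e) = -(y ^ (p ^ e)) * s := by
      have e1 : m - p ^ e = p ^ e * (s - 1) := by rw [h, Nat.mul_sub, mul_one]
      rw [h1, s15_coeff _ _ hP, e1, if_pos (dvd_mul_right _ _), Nat.mul_div_cancel_left _ hP]
      have e2 : s - (s - 1) = 1 := by omega
      have e3 : s.choose (s - 1) = s := by
        rw [Nat.choose_symm_of_eq_add (n := s) (a := s - 1) (b := 1) (by omega), Nat.choose_one_right]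
      rw [e2, e3, pow_one]
    rw [hF, coeff_map] at h3
    have hsK : (s : AlgebraicClosure k) ≠ 0 := by
      rwa [Ne, CharP.cast_eq_zero_iff (AlgebraicClosure k) p]
    rw [map_mul, h3, map_inv₀, map_natCast]
    field_simp
  apply map_injective _ (algebraMap k (AlgebraicClosure k)).injective
  rw [← hF, h1, ← h2]
  simp

/-- Let `k` be a finite field with `q` elements, `m, r ≥ 1`, and
`A₁, …, A_r ∈ Mat_m(k)`. If some `β ∈ k^r` makes `Σ βᵢ Aᵢ` have at least two distinct
eigenvalues in an algebraic closure of `k`, then the number of nonzero tuples `α ∈ k^r`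
for which `Σ αᵢ Aᵢ` has exactly one eigenvalue in the algebraic closure is at most
`m·(q^(r-1) - 1)`. -/
theorem statement_15 {k : Type*} [Field k] [Fintype k] (m r : ℕ) (hm : 1 ≤ m) (hr : 1 ≤ r)
    (A : Fin r → Matrix (Fin m) (Fin m) k)
    (hβ : ∃ β : Fin r → k, ∃ y₁ y₂ : AlgebraicClosure k, y₁ ≠ y₂ ∧
        Polynomial.aeval y₁ (Matrix.charpoly (∑ i, β i • A i)) = 0 ∧
        Polynomial.aeval y₂ (Matrix.charpoly (∑ i, β i • A i)) = 0) :
    Set.ncard {α : Fin r → k | α ≠ 0 ∧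
        ∃! y : AlgebraicClosure k, Polynomial.aeval y (Matrix.charpoly (∑ i, α i • A i)) = 0}
      ≤ m * (Fintype.card k ^ (r - 1) - 1) := by
  obtain ⟨β, y₁, y₂, hne, h1, h2⟩ := hβ
  obtain ⟨p, hpc⟩ := CharP.exists k
  haveI : Fact p.Prime := ⟨CharP.char_is_prime k p⟩
  haveI : CharP (AlgebraicClosure k) p := charP_of_injective_algebraMap
    (algebraMap k (AlgebraicClosure k)).injective p
  obtain ⟨e, s, hs, hms⟩ := Nat.exists_eq_pow_mul_and_not_dvd (n := m) (by omega) p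
    (Fact.out : p.Prime).ne_one
  have hP : 0 < p ^ e := pow_pos (Fact.out : p.Prime).pos _
  have hs0 : 0 < s := Nat.pos_of_ne_zero (by rintro rfl; simp at hs)
  have hβ0 : β ≠ 0 := by
    rintro rfl
    simp [Matrix.charpoly_zero] at h1 h2
    exact hne (h1.1.trans h2.1.symm)
  have hdeg : ∀ M : Matrix (Fin m) (Fin m) k, M.charpoly.natDegree = m := by
    intro M; simp [Matrix.charpoly_natDegree_eq_dim]
  have hneq : (∑ i, β i • A i).charpoly ≠ (Polynomial.X ^ (p ^ e) +
      Polynomial.C ((s : k)⁻¹ * (∑ i, β i • A i).charpoly.coeff (m - p ^ e))) ^ s := by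
    intro h
    rw [h] at h1 h2
    simp only [map_pow, map_add, Polynomial.aeval_X, Polynomial.aeval_C] at h1 h2
    have h1 := eq_zero_of_pow_eq_zero h1
    have h2 := eq_zero_of_pow_eq_zero h2
    apply hne
    apply iterateFrobenius_inj (AlgebraicClosure k) p e
    rw [iterateFrobenius_def, iterateFrobenius_def]
    exact add_right_cancel (h1.trans h2.symm)
  obtain ⟨i, hi⟩ : ∃ i, MvPolynomial.eval
      (fun ij : Fin m × Fin m => (∑ i, β i • A i) ij.1 ij.2) (s15G k m (p ^ e) s i) ≠ 0 := by
    by_contra! hcon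
    apply hneq
    ext i
    have := hcon i
    rw [s15G_eval _ _ _ _ hP] at this
    exact sub_eq_zero.1 this
  have him : i ≤ m := by
    by_contra! hlt
    apply hi
    rw [s15G_eval _ _ _ _ hP, Polynomial.coeff_eq_zero_of_natDegree_lt (by rwa [hdeg]),
      Polynomial.coeff_eq_zero_of_natDegree_lt, sub_zero]
    rw [Polynomial.natDegree_pow, Polynomial.natDegree_X_pow_add_C, mul_comm, ← hms]
    exact hlt
  let L : (Fin r → k) →ₗ[k] (Fin m × Fin m → k) :=
    { toFun := fun α ij => (∑ i, α i • A i) ij.1 ij.2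
      map_add' := by intro a b; ext ij; simp [add_smul, Finset.sum_add_distrib]
      map_smul' := by intro a b; ext ij; simp [mul_smul, ← Finset.smul_sum] }
  refine s15_count m r (m - i) (Nat.sub_le _ _) L _ (s15G_hom k m (p ^ e) s i hP hs0 hms him)
    β hβ0 hi _ ?_
  rintro α ⟨ha, hu⟩
  refine ⟨ha, ?_⟩
  have := s15_unique p e m s hs hms _ (Matrix.charpoly_monic _) (hdeg _) hu
  change MvPolynomial.eval (fun ij : Fin m × Fin m => (∑ i, α i • A i) ij.1 ij.2) _ = 0
  rw [s15G_eval _ _ _ _ hP, ← this, sub_self]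
end
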